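/- Let 𝓑 be a set of coset representatives of Z_{S,q} = {rI ∈ Z : r ∈ K_{S,q}} in Z, let 𝓐 be a set of representatives of the Z·GL(2,ℤ)-orbits in X_{S,q}, and let 𝓒 be a set of representatives of the Z-orbits in X_{S,q}, each chosen of the form gx with g ∈ GL(2,ℤ) and x ∈ 𝓐. Then the set { Σ_{ζ∈𝓑} q(ζ)⁻¹·ζx : x ∈ 𝓒 } is an 𝔽-basis of M_{S,q}. -/

import Mathlib

open scoped Pointwise Classical
open Matrix NumberField

noncomputable section

namespace AD

/-- The set `Y` of column vectors `(a,b)ᵀ ∈ K²` with `b ≠ 0` and `a/b ∉ ℚ`. -/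
def Y (K : Type*) [Field K] [NumberField K] : Set (Fin 2 → K) :=
  {y | y 1 ≠ 0 ∧ ∀ r : ℚ, y 0 ≠ algebraMap ℚ K r * y 1}

/-- The elements of `Y`, as a type. -/
def Ysub (K : Type*) [Field K] [NumberField K] := {y : Fin 2 → K // y ∈ Y K}

/-- The lattice `Λ_y = ℤ·(y 0) + ℤ·(y 1)` spanned by the entries of `y`. -/
def lat {K : Type*} [Field K] [NumberField K] (y : Fin 2 → K) : Submodule ℤ K :=
  Submodule.span ℤ {y 0, y 1}

/-- A lattice in `K`: a free `ℤ`-submodule of rank `2`; equivalently (since `K` is a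
`2`-dimensional `ℚ`-vector space) the `ℤ`-span of a pair of `ℚ`-linearly independent
elements of `K`. -/
def IsLat {K : Type*} [Field K] [NumberField K] (L : Submodule ℤ K) : Prop :=
  ∃ y : Fin 2 → K, LinearIndependent ℚ y ∧ L = lat y

/-- Scaling of a `ℤ`-submodule of `K` by `c ∈ K`:  `c • L`. -/
def smulLat {K : Type*} [Field K] [NumberField K] (c : K) (L : Submodule ℤ K) :
    Submodule ℤ K :=
  L.map (LinearMap.mulLeft ℤ c)

/-- The (left) action of a rational `2 × 2` matrix on column vectors in `K²`. -/
def act {K : Type*} [Field K] [NumberField K] (g : Matrix (Fin 2) (Fin 2) ℚ)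
    (y : Fin 2 → K) : Fin 2 → K :=
  (g.map (algebraMap ℚ K)).mulVec y

/-- The right scalar action of `K` on column vectors in `K²`: `y·c`. -/
def rsc {K : Type*} [Field K] [NumberField K] (y : Fin 2 → K) (c : K) : Fin 2 → K :=
  fun i => y i * c

/-- `GL(2,ℤ)`, viewed as the set of rational `2 × 2` matrices with integral entries
and determinant `±1`. -/
def GLZset : Set (Matrix (Fin 2) (Fin 2) ℚ) :=
  {g | (∀ i j, ∃ a : ℤ, g i j = (a : ℚ)) ∧ (g.det = 1 ∨ g.det = -1)}

end AD
namespace AD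

/-- Reduction of a rational number modulo `n` (this is the genuine reduction whenever the
denominator is coprime to `n`). -/
def ratRed (n : ℕ) (r : ℚ) : ZMod n := (r.num : ZMod n) * ((r.den : ZMod n))⁻¹

/-- `S₀(n)`: the largest subgroup of `GL(2,ℚ)` that can be mapped modulo `n` to
`GL(2,ℤ/nℤ)`, i.e. the invertible rational matrices which are `n`-integral and whose
reduction modulo `n` is invertible. -/
def S0set (n : ℕ) : Set (Matrix (Fin 2) (Fin 2) ℚ) :=
  {g | IsUnit g.det ∧ (∀ i j, Nat.Coprime (g i j).den n) ∧ IsUnit (g.map (ratRed n)).det}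

/-- `S = S(m) ∩ S₀(n)`: the elements of `S₀(n)` reducing to the identity modulo `m`. -/
def Sset (n m : ℕ) : Set (Matrix (Fin 2) (Fin 2) ℚ) :=
  {g | g ∈ S0set n ∧ g.map (ratRed m) = 1}

/-- `p`: the characteristic of `𝔽` when it is positive, and `1` when `char 𝔽 = 0`. -/
def pOf (𝔽 : Type*) [Field 𝔽] : ℕ := if ringChar 𝔽 = 0 then 1 else ringChar 𝔽

/-- The quantity `p·d·N` where `d` is (the absolute value of) the discriminant of `K`. -/
def pdN (𝔽 : Type*) [Field 𝔽] (K : Type*) [Field K] [NumberField K] (N : ℕ) : ℕ :=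
  pOf 𝔽 * (NumberField.discr K).natAbs * N

/-- `K_{S₀}` (for the level `n`): the set of `c ∈ K^×` such that `r_ω̄(c) ∈ S₀(n)`, where
`r_ω̄(c)` is the unique rational matrix with `r_ω̄(c)·ω̄ = ω̄·c` and `ω̄ = (ω,1)ᵀ`. -/
def KS0set (K : Type*) [Field K] [NumberField K] (n : ℕ) (ω : K) : Set K :=
  {c | ∃ g ∈ S0set n, act g ![ω, 1] = rsc ![ω, 1] c}

/-- `K_S`: the set of `c ∈ K^×` with `r_ω̄(c) ∈ S = S(m) ∩ S₀(n)`. -/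
def KSset (K : Type*) [Field K] [NumberField K] (n m : ℕ) (ω : K) : Set K :=
  {c | ∃ g ∈ Sset n m, act g ![ω, 1] = rsc ![ω, 1] c}

/-- The rational prime `ℓ` is inert in `K`: `ℓ𝒪` is a prime ideal of `𝒪`. -/
def IsInert (K : Type*) [Field K] [NumberField K] (ℓ : ℕ) : Prop :=
  ℓ.Prime ∧ (Ideal.span {(ℓ : 𝓞 K)}).IsPrime

/-- The total multiplicity of the inert primes in the factorization of `n`. -/
def inertMultNat (K : Type*) [Field K] [NumberField K] (n : ℕ) : ℕ :=
  n.factorization.sum fun ℓ e => if IsInert K ℓ then e else 0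

/-- The value `q(rI) = θ(r)` of the quadratic Dirichlet character `θ` cutting out the real
quadratic field `K` (characterized by `θ(-1) = 1`, `θ(ℓ) = 1` for `ℓ` split, `θ(ℓ) = -1`
for `ℓ` inert, extended multiplicatively), taken in `𝔽`. -/
def qRat (K : Type*) [Field K] [NumberField K] (𝔽 : Type*) [Field 𝔽] (r : ℚ) : 𝔽 :=
  (-1) ^ (inertMultNat K r.num.natAbs + inertMultNat K r.den)

/-- The number (with multiplicity) of inert prime ideal factors of the ideal `(x)`. -/
def inertCount (K : Type*) [Field K] [NumberField K] (x : 𝓞 K) : ℕ :=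
  Multiset.countP (fun P => ∃ ℓ : ℕ, IsInert K ℓ ∧ P = Ideal.span {(ℓ : 𝓞 K)})
    (UniqueFactorizationMonoid.factors (Ideal.span {x}))

/-- `q^*(α)`: the product, over the inert prime ideals `(ℓ)` occurring in the prime
factorization of the fractional ideal `α𝒪`, of `q(ℓI) = -1` raised to the corresponding
exponent. -/
def qstar (K : Type*) [Field K] [NumberField K] (𝔽 : Type*) [Field 𝔽] (α : K) : 𝔽 :=
  (-1) ^ (inertCount K (IsLocalization.sec (nonZeroDivisors (𝓞 K)) α).1 +
      inertCount K ((IsLocalization.sec (nonZeroDivisors (𝓞 K)) α).2 : 𝓞 K))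

/-- `K_{S,q}`: the kernel of `q^*` restricted to `K_S`. -/
def KSqSet (K : Type*) [Field K] [NumberField K] (𝔽 : Type*) [Field 𝔽] (n m : ℕ)
    (ω : K) : Set K :=
  {c | c ∈ KSset K n m ω ∧ qstar K 𝔽 c = 1}

/-- The scalars of the elements of `Z`: the matrix `rI` belongs to `Z` iff
`r ∈ ℚ^× ∩ K_{S₀}`. -/
def Zscal (K : Type*) [Field K] [NumberField K] (n : ℕ) (ω : K) : Set ℚ :=
  {r | r ≠ 0 ∧ algebraMap ℚ K r ∈ KS0set K n ω}

end AD
namespace AD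

/-- `H`-homothety: `y' = y·c` for some `c ∈ H`. -/
def homRel (K : Type*) [Field K] [NumberField K] (H : Set K) :
    Ysub K → Ysub K → Prop :=
  fun y y' => ∃ c ∈ H, y'.1 = rsc y.1 c

/-- The quotient `Y/H`. -/
def Xq (K : Type*) [Field K] [NumberField K] (H : Set K) := Quot (homRel K H)

/-- The class in `Y/H` of an element of `Y`. -/
def mkX (K : Type*) [Field K] [NumberField K] (H : Set K) (y : Ysub K) : Xq K H :=
  Quot.mk _ y

/-- `t` and `x` belong to the same `Z`-orbit of `Y/H`, i.e. `x = ζ·t` for some `ζ ∈ Z`. -/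
def zRel (K : Type*) [Field K] [NumberField K] (n : ℕ) (ω : K) (H : Set K)
    (t x : Xq K H) : Prop :=
  ∃ r ∈ Zscal K n ω, ∃ y y' : Ysub K, t = mkX K H y ∧ x = mkX K H y' ∧
    y'.1 = rsc y.1 (algebraMap ℚ K r)

/-- `a` and `x` belong to the same `Z·GL(2,ℤ)`-orbit of `Y/H`. -/
def zglRel (K : Type*) [Field K] [NumberField K] (n : ℕ) (ω : K) (H : Set K)
    (a x : Xq K H) : Prop :=
  ∃ r ∈ Zscal K n ω, ∃ γ ∈ GLZset, ∃ y y' : Ysub K, a = mkX K H y ∧ x = mkX K H y' ∧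
    y'.1 = act γ (rsc y.1 (algebraMap ℚ K r))

/-- The module `M_{S,q}`: formal sums `Σ c_x·x` over `x ∈ X_{S,q}` (coded as the function
`x ↦ c_x`) supported on finitely many `Z`-orbits and satisfying `c_{ζx} = q(ζ)⁻¹·c_x`
for all `ζ ∈ Z`. -/
def MSq (K : Type*) [Field K] [NumberField K] (𝔽 : Type*) [Field 𝔽] (n m : ℕ) (ω : K) :
    Submodule 𝔽 (Xq K (KSqSet K 𝔽 n m ω) → 𝔽) where
  carrier := {f |
    (∃ T : Finset (Xq K (KSqSet K 𝔽 n m ω)), ∀ x, f x ≠ 0 →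
        ∃ t ∈ T, zRel K n ω (KSqSet K 𝔽 n m ω) t x) ∧
    (∀ r ∈ Zscal K n ω, ∀ y y' : Ysub K,
        y'.1 = rsc y.1 (algebraMap ℚ K r) →
        f (mkX K (KSqSet K 𝔽 n m ω) y') = (qRat K 𝔽 r)⁻¹ * f (mkX K (KSqSet K 𝔽 n m ω) y))}
  add_mem' := by
    rintro f g ⟨⟨T₁, hT₁⟩, hf⟩ ⟨⟨T₂, hT₂⟩, hg⟩
    constructor
    · refine ⟨T₁ ∪ T₂, fun x hx => ?_⟩
      by_cases h : f x ≠ 0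
      · obtain ⟨t, ht, htx⟩ := hT₁ x h
        exact ⟨t, Finset.mem_union_left _ ht, htx⟩
      · push_neg at h
        have : g x ≠ 0 := fun hgx => hx (by simp [Pi.add_apply, h, hgx])
        obtain ⟨t, ht, htx⟩ := hT₂ x this
        exact ⟨t, Finset.mem_union_right _ ht, htx⟩
    · intro r hr y y' hy
      simp only [Pi.add_apply, hf r hr y y' hy, hg r hr y y' hy, mul_add]
  zero_mem' := by
    constructor
    · exact ⟨∅, fun x hx => absurd rfl hx⟩
    · intro r hr y y' hy
      simp
  smul_mem' := by
    rintro c f ⟨⟨T, hT⟩, hf⟩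
    constructor
    · refine ⟨T, fun x hx => ?_⟩
      have : f x ≠ 0 := fun h => hx (by simp [Pi.smul_apply, h])
      exact hT x this
    · intro r hr y y' hy
      simp only [Pi.smul_apply, smul_eq_mul, hf r hr y y' hy]
      ring

end AD
namespace AD

/-- `x' = ζ·x` for the specific element `ζ = rI` of `Z`. -/
def zScaleRel (K : Type*) [Field K] [NumberField K] (H : Set K) (r : ℚ)
    (x x' : Xq K H) : Prop :=
  ∃ y y' : Ysub K, x = mkX K H y ∧ x' = mkX K H y' ∧
    y'.1 = rsc y.1 (algebraMap ℚ K r)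

/-- The formal sum `Σ_{ζ ∈ 𝓑} q(ζ)⁻¹·(ζx)`, as the function sending `x'` to the sum of
`q(ζ)⁻¹` over those `ζ ∈ 𝓑` with `ζx = x'`. -/
def basisFun (K : Type*) [Field K] [NumberField K] (𝔽 : Type*) [Field 𝔽]
    (n m : ℕ) (ω : K) (𝓑 : Set ℚ) (x : Xq K (KSqSet K 𝔽 n m ω)) :
    Xq K (KSqSet K 𝔽 n m ω) → 𝔽 :=
  fun x' => ∑ᶠ ζ ∈ {ζ : ℚ | ζ ∈ 𝓑 ∧ zScaleRel K (KSqSet K 𝔽 n m ω) ζ x x'},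
    (qRat K 𝔽 ζ)⁻¹

section Counting

variable {K : Type*} [Field K] [NumberField K]

lemma inertCount_mul {x y : 𝓞 K} (hx : x ≠ 0) (hy : y ≠ 0) :
    inertCount K (x * y) = inertCount K x + inertCount K y := by
  have hx' : Ideal.span {x} ≠ 0 := by simpa using hx
  have hy' : Ideal.span {y} ≠ 0 := by simpa using hy
  have h := UniqueFactorizationMonoid.factors_mul hx' hy'
  rw [show Multiset.Rel Associated = Multiset.Rel (Eq : Ideal (𝓞 K) → _ → Prop) by
    congr 1; ext; exact associated_iff_eq, Multiset.rel_eq] at h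
  rw [inertCount, ← Ideal.span_singleton_mul_span_singleton, h, Multiset.countP_add]
  rfl

lemma inertCount_of_isUnit {x : 𝓞 K} (hx : IsUnit x) : inertCount K x = 0 := by
  have := inertCount_mul (K := K) (x := 1) (y := 1) one_ne_zero one_ne_zero
  rw [mul_one] at this
  rw [inertCount, Ideal.span_singleton_eq_top.mpr hx,
    ← Ideal.span_singleton_eq_top.mpr (isUnit_one (M := 𝓞 K))]
  change inertCount K 1 = 0
  omega

lemma inertCount_neg (x : 𝓞 K) : inertCount K (-x) = inertCount K x := by
  rw [inertCount, Ideal.span_singleton_neg, inertCount]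

lemma inertCount_intCast (a : ℤ) :
    inertCount K (a : 𝓞 K) = inertCount K ((a.natAbs : ℕ) : 𝓞 K) := by
  rcases Int.natAbs_eq a with h | h <;> conv_lhs => rw [h]
  · simp
  · rw [Int.cast_neg, inertCount_neg]
    simp

lemma inertMultNat_mul {a b : ℕ} (ha : a ≠ 0) (hb : b ≠ 0) :
    inertMultNat K (a * b) = inertMultNat K a + inertMultNat K b := by
  rw [inertMultNat, Nat.factorization_mul ha hb, Finsupp.sum_add_index']
  · rfl
  · intro; simp
  · intro ℓ e f; split_ifs <;> rfl

lemma inertMultNat_prime {ℓ : ℕ} (hℓ : ℓ.Prime) :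
    inertMultNat K ℓ = if IsInert K ℓ then 1 else 0 := by
  rw [inertMultNat, hℓ.factorization, Finsupp.sum_single_index]
  simp

/-- An inert prime ideal `(ℓ')` divides `(ℓ)`, with `ℓ` prime, only when `ℓ' = ℓ`. -/
lemma eq_of_mem_span {ℓ ℓ' : ℕ} (hℓ : ℓ.Prime) (hℓ' : IsInert K ℓ')
    (h : (ℓ : 𝓞 K) ∈ Ideal.span {(ℓ' : 𝓞 K)}) : ℓ = ℓ' := by
  by_contra hne
  have hco : IsCoprime (ℓ : ℤ) (ℓ' : ℤ) :=
    Nat.isCoprime_iff_coprime.mpr ((Nat.coprime_primes hℓ hℓ'.1).mpr hne)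
  obtain ⟨u, v, huv⟩ := hco
  apply hℓ'.2.ne_top
  rw [Ideal.eq_top_iff_one]
  have h1 : (1 : 𝓞 K) = (u : 𝓞 K) * ℓ + (v : 𝓞 K) * ℓ' := by exact_mod_cast huv.symm
  rw [h1]
  exact add_mem (Ideal.mul_mem_left _ _ h)
    (Ideal.mul_mem_left _ _ (Ideal.mem_span_singleton_self _))

lemma inertCount_prime {ℓ : ℕ} (hℓ : ℓ.Prime) :
    inertCount K (ℓ : 𝓞 K) = if IsInert K ℓ then 1 else 0 := by
  have h0 : Ideal.span {(ℓ : 𝓞 K)} ≠ 0 := by simpa using hℓ.ne_zero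
  split_ifs with hin
  · have hirr : Irreducible (Ideal.span {(ℓ : 𝓞 K)}) :=
      (Ideal.prime_of_isPrime h0 hin.2).irreducible
    obtain ⟨J, hJ, hJ'⟩ := UniqueFactorizationMonoid.factors_eq_singleton_of_irreducible hirr
    rw [associated_iff_eq] at hJ
    rw [inertCount, hJ', ← hJ, Multiset.countP_eq_card.mpr, Multiset.card_singleton]
    intro P hP
    exact ⟨ℓ, hin, Multiset.mem_singleton.mp hP⟩
  · rw [inertCount, Multiset.countP_eq_zero]
    rintro P hP ⟨ℓ', hℓ', rfl⟩
    have hdvd := UniqueFactorizationMonoid.dvd_of_mem_factors hP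
    have := eq_of_mem_span hℓ hℓ' (Ideal.dvd_iff_le.mp hdvd (Ideal.mem_span_singleton_self _))
    exact hin (this ▸ hℓ')

lemma inertCount_natCast {a : ℕ} (ha : a ≠ 0) :
    inertCount K (a : 𝓞 K) = inertMultNat K a := by
  induction a using Nat.recOnMul with
  | zero => exact absurd rfl ha
  | one => simp [inertCount_of_isUnit, inertMultNat]
  | prime p hp => rw [inertCount_prime hp, inertMultNat_prime hp]
  | mul a b iha ihb =>
    have ha' := left_ne_zero_of_mul ha
    have hb' := right_ne_zero_of_mul ha
    rw [Nat.cast_mul, inertCount_mul (by simpa using ha') (by simpa using hb'),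
      inertMultNat_mul ha' hb', iha ha', ihb hb']

variable (𝔽 : Type*) [Field 𝔽]

lemma neg_one_pow_add_eq {a b c d : ℕ} (h : a + d = b + c) :
    (-1 : 𝔽) ^ (a + c) = (-1) ^ (b + d) := by
  rw [neg_one_pow_eq_pow_mod_two, neg_one_pow_eq_pow_mod_two (b + d)]
  congr 1
  omega

lemma qstar_eq {α : K} {x s : 𝓞 K} (hx : x ≠ 0) (hs : s ≠ 0)
    (h : α * algebraMap (𝓞 K) K s = algebraMap (𝓞 K) K x) :
    qstar K 𝔽 α = (-1) ^ (inertCount K x + inertCount K s) := by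
  have hsec := IsLocalization.sec_spec (nonZeroDivisors (𝓞 K)) α
  unfold qstar
  set u := (IsLocalization.sec (nonZeroDivisors (𝓞 K)) α).1
  set v := (IsLocalization.sec (nonZeroDivisors (𝓞 K)) α).2
  have hv : (v : 𝓞 K) ≠ 0 := nonZeroDivisors.coe_ne_zero v
  have hmul : u * s = x * v := by
    apply FaithfulSMul.algebraMap_injective (𝓞 K) K
    rw [map_mul, map_mul, ← hsec, ← h]
    ring
  have hu : u ≠ 0 := by
    intro hu
    rw [hu, zero_mul] at hmul
    exact mul_ne_zero hx hv hmul.symm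
  apply neg_one_pow_add_eq
  rw [← inertCount_mul hu hs, ← inertCount_mul hx hv, hmul]

lemma exists_num_den {α : K} (hα : α ≠ 0) : ∃ x s : 𝓞 K, x ≠ 0 ∧ s ≠ 0 ∧
    α * algebraMap (𝓞 K) K s = algebraMap (𝓞 K) K x := by
  obtain ⟨⟨x, s⟩, h⟩ := IsLocalization.surj (nonZeroDivisors (𝓞 K)) α
  have hs : (s : 𝓞 K) ≠ 0 := nonZeroDivisors.coe_ne_zero s
  refine ⟨x, s, ?_, hs, h⟩
  rintro rfl
  simp [hα] at h

lemma qstar_mul {α β : K} (hα : α ≠ 0) (hβ : β ≠ 0) :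
    qstar K 𝔽 (α * β) = qstar K 𝔽 α * qstar K 𝔽 β := by
  obtain ⟨x, s, hx, hs, h⟩ := exists_num_den hα
  obtain ⟨x', s', hx', hs', h'⟩ := exists_num_den hβ
  rw [qstar_eq 𝔽 hx hs h, qstar_eq 𝔽 hx' hs' h',
    qstar_eq 𝔽 (mul_ne_zero hx hx') (mul_ne_zero hs hs'), inertCount_mul hx hx',
    inertCount_mul hs hs', ← pow_add]
  · congr 1; ring
  · rw [map_mul, map_mul, ← h, ← h']; ring

lemma qstar_one : qstar K 𝔽 (1 : K) = 1 := by
  rw [qstar_eq 𝔽 (one_ne_zero (α := 𝓞 K)) (one_ne_zero (α := 𝓞 K)) (by simp),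
    inertCount_of_isUnit isUnit_one]
  simp

lemma qstar_algebraMap {r : ℚ} (hr : r ≠ 0) :
    qstar K 𝔽 (algebraMap ℚ K r) = qRat K 𝔽 r := by
  have hn : r.num ≠ 0 := Rat.num_ne_zero.mpr hr
  rw [qstar_eq 𝔽 (x := (r.num : 𝓞 K)) (s := (r.den : 𝓞 K)) (by simpa using hn)
    (by simp), inertCount_intCast, inertCount_natCast (Int.natAbs_ne_zero.mpr hn),
    inertCount_natCast r.den_nz]
  · rfl
  · rw [map_intCast, map_natCast, ← map_natCast (algebraMap ℚ K), ← map_mul,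
      Rat.mul_den_eq_num, map_intCast]

lemma qRat_mul {r s : ℚ} (hr : r ≠ 0) (hs : s ≠ 0) :
    qRat K 𝔽 (r * s) = qRat K 𝔽 r * qRat K 𝔽 s := by
  rw [← qstar_algebraMap 𝔽 hr, ← qstar_algebraMap 𝔽 hs, ← qstar_algebraMap 𝔽 (mul_ne_zero hr hs),
    map_mul, qstar_mul 𝔽 (by simpa using hr) (by simpa using hs)]

end Counting

section Reduction

/-- The ring of rational numbers whose denominator is coprime to `n`. -/
def integralAt (n : ℕ) : Subring ℚ where
  carrier := {r | r.den.Coprime n}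
  mul_mem' ha hb := Nat.Coprime.of_dvd_left (Rat.mul_den_dvd _ _) (Nat.Coprime.mul_left ha hb)
  one_mem' := by simp
  add_mem' ha hb := Nat.Coprime.of_dvd_left (Rat.add_den_dvd _ _) (Nat.Coprime.mul_left ha hb)
  zero_mem' := by simp
  neg_mem' ha := by simpa using ha

lemma ratRed_mul_eq {n : ℕ} {r : ℚ} (hr : r.den.Coprime n) {a b : ℤ} (h : r * b = a) :
    ratRed n r * b = a := by
  have hu : (r.den : ZMod n) * (r.den : ZMod n)⁻¹ = 1 := ZMod.coe_mul_inv_eq_one _ hr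
  have hz : r.num * b = a * r.den := by
    have : (r.num : ℚ) * b = a * r.den := by rw [← Rat.mul_den_eq_num r, ← h]; ring
    exact_mod_cast this
  have hz' : (r.num : ZMod n) * b = a * r.den := by exact_mod_cast congrArg (Int.cast) hz
  rw [ratRed, mul_right_comm, hz', mul_assoc, hu, mul_one]

lemma ratRed_eq_of_mul {n : ℕ} {r : ℚ} (hr : r.den.Coprime n) {a : ℤ} {b : ℕ}
    (hb : b.Coprime n) (h : r * b = a) {t : ZMod n} (ht : t * b = a) : ratRed n r = t := by
  have hu : IsUnit (b : ZMod n) := (ZMod.isUnit_iff_coprime b n).mpr hb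
  apply hu.mul_right_cancel
  rw [ht]
  exact_mod_cast ratRed_mul_eq hr (a := a) (b := b) (by exact_mod_cast h)

lemma ratRed_mul_den {n : ℕ} {r : ℚ} (hr : r.den.Coprime n) :
    ratRed n r * r.den = (r.num : ZMod n) := by
  exact_mod_cast ratRed_mul_eq hr (a := r.num) (b := r.den) (by simp)

/-- Reduction modulo a divisor `m` of `n`, as a ring homomorphism. -/
def redHom {n m : ℕ} (hmn : m ∣ n) : integralAt n →+* ZMod m where
  toFun r := ratRed m r
  map_one' := by simp [ratRed]
  map_zero' := by simp [ratRed]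
  map_mul' r s := by
    have hr : (r : ℚ).den.Coprime m := r.2.of_dvd_right hmn
    have hs : (s : ℚ).den.Coprime m := s.2.of_dvd_right hmn
    refine ratRed_eq_of_mul ((r * s).2.of_dvd_right hmn)
      (a := (r : ℚ).num * (s : ℚ).num) (b := (r : ℚ).den * (s : ℚ).den) (hr.mul_left hs) ?_ ?_
    · push_cast
      rw [← Rat.mul_den_eq_num r, ← Rat.mul_den_eq_num s]; ring
    · push_cast
      rw [← ratRed_mul_den hr, ← ratRed_mul_den hs]; ring
  map_add' r s := by
    have hr : (r : ℚ).den.Coprime m := r.2.of_dvd_right hmn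
    have hs : (s : ℚ).den.Coprime m := s.2.of_dvd_right hmn
    refine ratRed_eq_of_mul ((r + s).2.of_dvd_right hmn)
      (a := (r : ℚ).num * (s : ℚ).den + (s : ℚ).num * (r : ℚ).den)
      (b := (r : ℚ).den * (s : ℚ).den) (hr.mul_left hs) ?_ ?_
    · push_cast
      rw [← Rat.mul_den_eq_num r, ← Rat.mul_den_eq_num s]; ring
    · push_cast
      rw [← ratRed_mul_den hr, ← ratRed_mul_den hs]; ring

lemma isUnit_integralAt {n : ℕ} {r : integralAt n} (h0 : (r : ℚ) ≠ 0)
    (h : IsUnit (redHom dvd_rfl r)) : IsUnit r := by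
  have hr : (r : ℚ).den.Coprime n := r.2
  have hnum : IsUnit ((r : ℚ).num : ZMod n) := by
    rw [← ratRed_mul_den hr]
    exact h.mul ((ZMod.isUnit_iff_coprime _ n).mpr hr)
  have hco : (r : ℚ).num.natAbs.Coprime n := by
    rw [← ZMod.isUnit_iff_coprime]
    rcases Int.natAbs_eq (r : ℚ).num with h' | h' <;> rw [h'] at hnum <;> simpa using hnum
  have hinv : (r : ℚ)⁻¹ ∈ integralAt n := by
    change ((r : ℚ)⁻¹).den.Coprime n
    rwa [Rat.den_inv, if_neg (by simpa using h0)]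
  exact IsUnit.of_mul_eq_one ⟨_, hinv⟩ (Subtype.ext (mul_inv_cancel₀ h0))

lemma mem_S0set_iff {n : ℕ} {g : Matrix (Fin 2) (Fin 2) ℚ} :
    g ∈ S0set n ↔ ∃ h : GL (Fin 2) (integralAt n), h.1.map (integralAt n).subtype = g := by
  constructor
  · rintro ⟨h1, h2, h3⟩
    let h : Matrix (Fin 2) (Fin 2) (integralAt n) := fun i j => ⟨g i j, h2 i j⟩
    have hdet : IsUnit h.det := by
      apply isUnit_integralAt
      · change (integralAt n).subtype h.det ≠ 0
        rw [RingHom.map_det]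
        exact h1.ne_zero
      · rw [RingHom.map_det]
        exact h3
    exact ⟨h.nonsingInvUnit hdet, rfl⟩
  · rintro ⟨h, rfl⟩
    have hdet : IsUnit h.1.det := (Matrix.isUnit_iff_isUnit_det _).mp h.isUnit
    refine ⟨?_, fun i j => (h.1 i j).2, ?_⟩
    · have := hdet.map (integralAt n).subtype
      rwa [RingHom.map_det] at this
    · have := hdet.map (redHom (dvd_refl n))
      rwa [RingHom.map_det] at this

lemma mem_Sset_iff {n m : ℕ} (hmn : m ∣ n) {g : Matrix (Fin 2) (Fin 2) ℚ} :
    g ∈ Sset n m ↔ ∃ h : GL (Fin 2) (integralAt n), h.1.map (integralAt n).subtype = g ∧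
      GeneralLinearGroup.map (redHom hmn) h = 1 := by
  constructor
  · rintro ⟨h1, h2⟩
    obtain ⟨h, rfl⟩ := mem_S0set_iff.mp h1
    exact ⟨h, rfl, Units.ext h2⟩
  · rintro ⟨h, rfl, h2⟩
    exact ⟨mem_S0set_iff.mpr ⟨h, rfl⟩, congrArg Units.val h2⟩

end Reduction

section Multipliers

variable {K : Type*} [Field K] [NumberField K]

lemma act_mul (g h : Matrix (Fin 2) (Fin 2) ℚ) (y : Fin 2 → K) :
    act (g * h) y = act g (act h y) := by
  rw [act, act, act, Matrix.map_mul, Matrix.mulVec_mulVec]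

lemma act_one (y : Fin 2 → K) : act 1 y = y := by
  simp [act]

lemma rsc_eq_smul (y : Fin 2 → K) (c : K) : rsc y c = c • y := by
  ext i
  simp [rsc, mul_comm]

lemma rsc_rsc (y : Fin 2 → K) (c d : K) : rsc (rsc y c) d = rsc y (c * d) := by
  ext i
  simp [rsc, mul_assoc]

lemma rsc_one (y : Fin 2 → K) : rsc y 1 = y := by
  ext i
  simp [rsc]

lemma act_rsc (g : Matrix (Fin 2) (Fin 2) ℚ) (y : Fin 2 → K) (c : K) :
    act g (rsc y c) = rsc (act g y) c := by
  simp [act, rsc_eq_smul, Matrix.mulVec_smul]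

/-- The group of `c ∈ K^×` such that multiplication by `c` on `y` is given by an element of the
subgroup `U` of `GL(2, R)`, where `R ⊆ ℚ`. -/
def multiplierGroup {R : Subring ℚ} (U : Subgroup (GL (Fin 2) R)) (y : Fin 2 → K) :
    Subgroup Kˣ where
  carrier := {c | ∃ h ∈ U, act (h.1.map R.subtype) y = rsc y c}
  one_mem' := ⟨1, one_mem _, by simp [rsc_eq_smul, act_one]⟩
  mul_mem' := by
    rintro c d ⟨g, hg, hgc⟩ ⟨h, hh, hhd⟩
    refine ⟨g * h, mul_mem hg hh, ?_⟩
    rw [Units.val_mul, Matrix.map_mul, act_mul, hhd, act_rsc, hgc, rsc_rsc, Units.val_mul]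
  inv_mem' := by
    rintro c ⟨g, hg, hgc⟩
    refine ⟨g⁻¹, inv_mem hg, ?_⟩
    have h1 : act ((g⁻¹).1.map R.subtype) (act (g.1.map R.subtype) y) = y := by
      rw [← act_mul, ← Matrix.map_mul, ← Units.val_mul, inv_mul_cancel]
      simp [act_one]
    rw [hgc, act_rsc, rsc_eq_smul] at h1
    rw [rsc_eq_smul]
    nth_rewrite 2 [← h1]
    rw [smul_smul]
    simp

lemma ne_zero_of_act_eq {g : Matrix (Fin 2) (Fin 2) ℚ} (hg : IsUnit g.det) {ω c : K}
    (h : act g ![ω, 1] = rsc ![ω, 1] c) : c ≠ 0 := by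
  rintro rfl
  have h1 : act g⁻¹ (act g ![ω, 1]) = ![ω, 1] := by
    rw [← act_mul, Matrix.nonsing_inv_mul _ hg, act_one]
  rw [h, act_rsc, rsc_eq_smul, zero_smul] at h1
  have := congrFun h1 1
  simp at this

lemma mem_KS0set_iff {n : ℕ} {ω c : K} :
    c ∈ KS0set K n ω ↔ ∃ u ∈ multiplierGroup (⊤ : Subgroup (GL (Fin 2) (integralAt n))) ![ω, 1],
      (u : K) = c := by
  constructor
  · rintro ⟨g, hg, h⟩
    have hc := ne_zero_of_act_eq hg.1 h
    obtain ⟨g, rfl⟩ := mem_S0set_iff.mp hg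
    exact ⟨Units.mk0 c hc, ⟨g, trivial, h⟩, rfl⟩
  · rintro ⟨u, ⟨g, -, h⟩, rfl⟩
    exact ⟨_, mem_S0set_iff.mpr ⟨g, rfl⟩, h⟩

lemma mem_KSset_iff {n m : ℕ} (hmn : m ∣ n) {ω c : K} :
    c ∈ KSset K n m ω ↔
      ∃ u ∈ multiplierGroup (GeneralLinearGroup.map (n := Fin 2) (redHom hmn)).ker ![ω, 1],
        (u : K) = c := by
  constructor
  · rintro ⟨g, hg, h⟩
    have hc := ne_zero_of_act_eq hg.1.1 h
    obtain ⟨g, rfl, hg'⟩ := (mem_Sset_iff hmn).mp hg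
    exact ⟨Units.mk0 c hc, ⟨g, hg', h⟩, rfl⟩
  · rintro ⟨u, ⟨g, hg', h⟩, rfl⟩
    exact ⟨_, (mem_Sset_iff hmn).mpr ⟨g, rfl, hg'⟩, h⟩

/-- `q^*` as a homomorphism on `K^×`. -/
def qstarHom (K : Type*) [Field K] [NumberField K] (𝔽 : Type*) [Field 𝔽] : Kˣ →* 𝔽 where
  toFun u := qstar K 𝔽 u
  map_one' := qstar_one 𝔽
  map_mul' u v := qstar_mul 𝔽 u.ne_zero v.ne_zero

/-- `K_{S,q}` as a subgroup of `K^×`. -/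
def KSqSubgroup (K : Type*) [Field K] [NumberField K] (𝔽 : Type*) [Field 𝔽] {n m : ℕ}
    (hmn : m ∣ n) (ω : K) : Subgroup Kˣ :=
  multiplierGroup (GeneralLinearGroup.map (n := Fin 2) (redHom hmn)).ker ![ω, 1] ⊓
    (qstarHom K 𝔽).ker

lemma KSqSet_eq_image (𝔽 : Type*) [Field 𝔽] {n m : ℕ} (hmn : m ∣ n) (ω : K) :
    KSqSet K 𝔽 n m ω = Units.val '' (KSqSubgroup K 𝔽 hmn ω : Set Kˣ) := by
  ext c
  constructor
  · rintro ⟨hc, hq⟩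
    obtain ⟨u, hu, rfl⟩ := (mem_KSset_iff hmn).mp hc
    exact ⟨u, ⟨hu, hq⟩, rfl⟩
  · rintro ⟨u, ⟨hu, hq⟩, rfl⟩
    exact ⟨(mem_KSset_iff hmn).mpr ⟨u, hu, rfl⟩, hq⟩

/-- The group `Z`, as a subgroup of `ℚ^×`. -/
def scalarGroup (K : Type*) [Field K] [NumberField K] (n : ℕ) (ω : K) : Subgroup ℚˣ :=
  (multiplierGroup (⊤ : Subgroup (GL (Fin 2) (integralAt n))) ![ω, 1]).comap
    (Units.map (algebraMap ℚ K).toMonoidHom)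

lemma mem_scalarGroup_iff {n : ℕ} {ω : K} {r : ℚˣ} :
    r ∈ scalarGroup K n ω ↔ (r : ℚ) ∈ Zscal K n ω := by
  constructor
  · intro h
    exact ⟨r.ne_zero, mem_KS0set_iff.mpr ⟨_, h, rfl⟩⟩
  · rintro ⟨-, h⟩
    obtain ⟨u, hu, hur⟩ := mem_KS0set_iff.mp h
    have : u = Units.map (algebraMap ℚ K).toMonoidHom r := Units.ext hur
    rw [this] at hu
    exact hu

end Multipliers

section Action

variable {K : Type*} [Field K] [NumberField K]

lemma rsc_mem_Y {y : Fin 2 → K} (hy : y ∈ Y K) {c : K} (hc : c ≠ 0) : rsc y c ∈ Y K := by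
  refine ⟨mul_ne_zero hy.1 hc, fun r h => hy.2 r (mul_right_cancel₀ hc ?_)⟩
  rw [mul_assoc]
  exact h

/-- Scaling of an element of `Y` by a nonzero rational number. -/
def Ysub.scale (r : ℚˣ) (y : Ysub K) : Ysub K :=
  ⟨rsc y.1 (algebraMap ℚ K r), rsc_mem_Y y.2 (by simp)⟩

instance (H : Set K) : MulAction ℚˣ (Xq K H) where
  smul r := Quot.map (Ysub.scale r) (by
    rintro y y' ⟨c, hc, h⟩
    refine ⟨c, hc, ?_⟩
    simp only [Ysub.scale, h, rsc_rsc, mul_comm])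
  one_smul := by
    rintro ⟨y⟩
    refine congrArg (Quot.mk _) (Subtype.ext ?_)
    simp [Ysub.scale, rsc_one]
  mul_smul r s := by
    rintro ⟨y⟩
    refine congrArg (Quot.mk _) (Subtype.ext ?_)
    simp [Ysub.scale, rsc_rsc, mul_comm]

lemma smul_mkX {H : Set K} {r : ℚˣ} {y y' : Ysub K}
    (h : y'.1 = rsc y.1 (algebraMap ℚ K r)) : mkX K H y' = r • mkX K H y :=
  congrArg (Quot.mk _) (Subtype.ext h)

lemma zScaleRel_iff {H : Set K} {r : ℚˣ} {x x' : Xq K H} :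
    zScaleRel K H r x x' ↔ x' = r • x := by
  constructor
  · rintro ⟨y, y', rfl, rfl, h⟩
    exact smul_mkX h
  · rintro rfl
    obtain ⟨y, rfl⟩ := Quot.exists_rep x
    exact ⟨y, y.scale r, rfl, rfl, rfl⟩

lemma zRel_iff {n : ℕ} {ω : K} {H : Set K} {t x : Xq K H} :
    zRel K n ω H t x ↔ ∃ r ∈ scalarGroup K n ω, x = r • t := by
  constructor
  · rintro ⟨r, hr, h⟩
    refine ⟨Units.mk0 r hr.1, mem_scalarGroup_iff.mpr hr, zScaleRel_iff.mp h⟩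
  · rintro ⟨r, hr, h⟩
    exact ⟨r, mem_scalarGroup_iff.mp hr, zScaleRel_iff.mpr h⟩

lemma mkX_eq_iff {H : Set K} {G : Subgroup Kˣ} (hH : H = Units.val '' (G : Set Kˣ))
    {y y' : Ysub K} : mkX K H y = mkX K H y' ↔ homRel K H y y' := by
  subst hH
  refine Quot.eq.trans (Equivalence.eqvGen_iff ⟨fun y => ?_, ?_, ?_⟩)
  · exact ⟨1, ⟨1, one_mem G, rfl⟩, (rsc_one _).symm⟩
  · rintro y y' ⟨_, ⟨c, hc, rfl⟩, h⟩
    exact ⟨_, ⟨c⁻¹, inv_mem hc, rfl⟩, by rw [h, rsc_rsc, Units.mul_inv, rsc_one]⟩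
  · rintro y y' y'' ⟨_, ⟨c, hc, rfl⟩, h⟩ ⟨_, ⟨d, hd, rfl⟩, h'⟩
    exact ⟨_, ⟨c * d, mul_mem hc hd, rfl⟩, by rw [h', h, rsc_rsc, Units.val_mul]⟩

lemma smul_eq_smul_iff {H : Set K} {G : Subgroup Kˣ} (hH : H = Units.val '' (G : Set Kˣ))
    {r s : ℚˣ} {x : Xq K H} : r • x = s • x ↔ algebraMap ℚ K (s / r) ∈ H := by
  obtain ⟨y, rfl⟩ := Quot.exists_rep x
  refine (mkX_eq_iff hH (y := y.scale r) (y' := y.scale s)).trans ⟨?_, fun h => ⟨_, h, ?_⟩⟩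
  · rintro ⟨c, hc, h⟩
    have h1 := congrFun h 1
    simp only [Ysub.scale, rsc] at h1
    rw [mul_assoc] at h1
    have h2 := mul_left_cancel₀ y.2.1 h1
    convert hc
    rw [map_div₀, h2, mul_div_cancel_left₀ _ (by simp)]
  · simp only [Ysub.scale, rsc_rsc, ← map_mul]
    rw [mul_div_cancel₀ _ r.ne_zero]

end Action

section EquivariantBasis

/-- Functions on a `G`-set `X` that are supported on finitely many orbits of a subgroup `Z` and
transform under `Z` by `q⁻¹` have a basis indexed by representatives of the `Z`-orbits. -/
lemma equivariant_basis {G X 𝔽 : Type*} [Group G] [MulAction G X] [Field 𝔽] (Z : Subgroup G)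
    (q : G → 𝔽) (hq : q 1 = 1) (hq' : ∀ r s, q (r * s) = q r * q s) (𝓒 : Set X)
    (h𝓒 : ∀ x, ∃! c, c ∈ 𝓒 ∧ ∃ r ∈ Z, x = r • c) (b : X → X → 𝔽)
    (hb : ∀ x, ∀ r ∈ Z, b x (r • x) = (q r)⁻¹)
    (hb' : ∀ x x', (∀ r ∈ Z, x' ≠ r • x) → b x x' = 0) (M : Submodule 𝔽 (X → 𝔽))
    (hM : ∀ f, f ∈ M ↔ (∃ T : Finset X, ∀ x, f x ≠ 0 → ∃ t ∈ T, ∃ r ∈ Z, x = r • t) ∧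
      ∀ r ∈ Z, ∀ x, f (r • x) = (q r)⁻¹ * f x) :
    LinearIndependent 𝔽 (fun c : 𝓒 => b c) ∧
      Submodule.span 𝔽 (Set.range (fun c : 𝓒 => b c)) = M := by
  have hbM (c : X) : b c ∈ M := by
    refine (hM _).mpr ⟨⟨{c}, fun x hx => ⟨c, Finset.mem_singleton_self c, ?_⟩⟩, fun r hr x => ?_⟩
    · by_contra! h
      exact hx (hb' c x h)
    · by_cases h : ∃ s ∈ Z, x = s • c
      · obtain ⟨s, hs, rfl⟩ := h
        rw [← mul_smul, hb c _ (mul_mem hr hs), hb c s hs, hq', mul_inv]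
      · push Not at h
        rw [hb' c x h, hb' c, mul_zero]
        intro s hs heq
        refine h (r⁻¹ * s) (mul_mem (inv_mem hr) hs) ?_
        rw [mul_smul, ← heq, inv_smul_smul]
  have hself (c : X) : b c c = 1 := by simpa [hq] using hb c 1 (one_mem _)
  have hne (c c' : 𝓒) (h : c ≠ c') : b c c' = 0 := by
    refine hb' _ _ fun r hr heq => h (Subtype.ext ?_)
    exact (h𝓒 c').unique ⟨c.2, r, hr, heq⟩ ⟨c'.2, 1, one_mem _, by simp⟩
  have heval (s : Finset 𝓒) (w : 𝓒 → 𝔽) (c : 𝓒) :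
      (∑ d ∈ s, w d • b d) c = if c ∈ s then w c else 0 := by
    rw [Finset.sum_apply]
    split_ifs with hc
    · rw [Finset.sum_eq_single_of_mem c hc fun d _ hd => by simp [hne d c hd]]
      simp [hself]
    · refine Finset.sum_eq_zero fun d hd => ?_
      simp [hne d c fun h => hc (h ▸ hd)]
  refine ⟨?_, le_antisymm ?_ ?_⟩
  · rw [linearIndependent_iff']
    intro s w h c hc
    have := heval s w c
    rw [h, if_pos hc] at this
    exact this.symm
  · rw [Submodule.span_le]
    rintro _ ⟨c, rfl⟩
    exact hbM c
  · intro f hf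
    obtain ⟨⟨T, hT⟩, -⟩ := (hM f).mp hf
    choose rep hrep using fun x => (h𝓒 x).exists
    let s : Finset 𝓒 := T.image fun t => ⟨rep t, (hrep t).1⟩
    let g : X → 𝔽 := ∑ c ∈ s, f c • b c
    have hg : g ∈ M := Submodule.sum_mem _ fun c _ => M.smul_mem _ (hbM c)
    have hgspan : g ∈ Submodule.span 𝔽 (Set.range (fun c : 𝓒 => b c)) :=
      Submodule.sum_mem _ fun c _ => Submodule.smul_mem _ _ (Submodule.subset_span ⟨c, rfl⟩)
    suffices f = g by rwa [this]
    have hC (c : 𝓒) : f c = g c := by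
      refine Eq.trans ?_ (heval s (fun c => f c) c).symm
      split_ifs with hc
      · rfl
      · by_contra hfc
        obtain ⟨t, ht, r, hr, hct⟩ := hT c hfc
        apply hc
        refine Finset.mem_image.mpr ⟨t, ht, Subtype.ext ?_⟩
        obtain ⟨h1, s, hs, h2⟩ := hrep t
        refine (h𝓒 c).unique ⟨h1, r * s, mul_mem hr hs, ?_⟩ ⟨c.2, 1, one_mem _, by simp⟩
        rw [mul_smul, ← h2, hct]
    ext x
    obtain ⟨h1, r, hr, h2⟩ := hrep x
    rw [h2, ((hM f).mp hf).2 r hr, ((hM g).mp hg).2 r hr, hC ⟨_, h1⟩]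

end EquivariantBasis

/-- STATEMENT 11.  Let `𝓑` be a set of coset representatives of
`Z_{S,q} = {rI ∈ Z : r ∈ K_{S,q}}` in `Z`, let `𝓐` be a set of representatives of the
`Z·GL(2,ℤ)`-orbits in `X_{S,q}`, and let `𝓒` be a set of representatives of the
`Z`-orbits in `X_{S,q}`, each of the form `g·x` with `g ∈ GL(2,ℤ)` and `x ∈ 𝓐`.  Then
`{ Σ_{ζ ∈ 𝓑} q(ζ)⁻¹·ζx : x ∈ 𝓒 }` is an `𝔽`-basis of `M_{S,q}`. -/
theorem statement_11 (K : Type) [Field K] [NumberField K]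
    (hdeg : Module.finrank ℚ K = 2) (hreal : Nonempty (K →+* ℝ))
    (ω : 𝓞 K) (hω : Algebra.adjoin ℤ {ω} = ⊤)
    (𝔽 : Type) [Field 𝔽] (hchar : ringChar 𝔽 ≠ 2)
    (N Mlev : ℕ) (hN : 0 < N) (hMlev : 3 ≤ Mlev) (hdvd : Mlev ∣ pdN 𝔽 K N)
    (𝓑 : Set ℚ) (h𝓑 : 𝓑 ⊆ Zscal K (pdN 𝔽 K N) (algebraMap (𝓞 K) K ω))
    (h𝓑' : ∀ r ∈ Zscal K (pdN 𝔽 K N) (algebraMap (𝓞 K) K ω),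
      ∃! b, b ∈ 𝓑 ∧ algebraMap ℚ K (r / b) ∈
        KSqSet K 𝔽 (pdN 𝔽 K N) Mlev (algebraMap (𝓞 K) K ω))
    (𝓐 𝓒 : Set (Xq K (KSqSet K 𝔽 (pdN 𝔽 K N) Mlev (algebraMap (𝓞 K) K ω))))
    (h𝓐 : ∀ x, ∃! a, a ∈ 𝓐 ∧
      zglRel K (pdN 𝔽 K N) (algebraMap (𝓞 K) K ω)
        (KSqSet K 𝔽 (pdN 𝔽 K N) Mlev (algebraMap (𝓞 K) K ω)) a x)
    (h𝓒 : ∀ x, ∃! c, c ∈ 𝓒 ∧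
      zRel K (pdN 𝔽 K N) (algebraMap (𝓞 K) K ω)
        (KSqSet K 𝔽 (pdN 𝔽 K N) Mlev (algebraMap (𝓞 K) K ω)) c x)
    (h𝓒' : ∀ c ∈ 𝓒, ∃ a ∈ 𝓐, ∃ γ ∈ GLZset, ∃ y y' : Ysub K,
      a = mkX K (KSqSet K 𝔽 (pdN 𝔽 K N) Mlev (algebraMap (𝓞 K) K ω)) y ∧
      c = mkX K (KSqSet K 𝔽 (pdN 𝔽 K N) Mlev (algebraMap (𝓞 K) K ω)) y' ∧
      y'.1 = act γ y.1) :
    LinearIndependent 𝔽 (fun c : ↥𝓒 =>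
      basisFun K 𝔽 (pdN 𝔽 K N) Mlev (algebraMap (𝓞 K) K ω) 𝓑 c.1) ∧
    Submodule.span 𝔽 (Set.range (fun c : ↥𝓒 =>
        basisFun K 𝔽 (pdN 𝔽 K N) Mlev (algebraMap (𝓞 K) K ω) 𝓑 c.1)) =
      MSq K 𝔽 (pdN 𝔽 K N) Mlev (algebraMap (𝓞 K) K ω) := by
  have hH := KSqSet_eq_image (K := K) 𝔽 hdvd (algebraMap (𝓞 K) K ω)
  have hone : qRat K 𝔽 1 = 1 := by
    rw [← qstar_algebraMap 𝔽 one_ne_zero, map_one, qstar_one]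
  have hqr (r : ℚ) : qRat K 𝔽 r ≠ 0 := pow_ne_zero _ (by simp)
  refine equivariant_basis (scalarGroup K (pdN 𝔽 K N) (algebraMap (𝓞 K) K ω))
    (fun r => qRat K 𝔽 r) hone (fun r s => qRat_mul 𝔽 r.ne_zero s.ne_zero) 𝓒
    (fun x => by simpa only [zRel_iff] using h𝓒 x) _ ?_ ?_ _ ?_
  · intro x r hr
    obtain ⟨b, ⟨hb, hbr⟩, huniq⟩ := h𝓑' r (mem_scalarGroup_iff.mp hr)
    have hb0 := (h𝓑 hb).1
    have hset : {ζ : ℚ | ζ ∈ 𝓑 ∧ zScaleRel K (KSqSet K 𝔽 (pdN 𝔽 K N) Mlev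
        (algebraMap (𝓞 K) K ω)) ζ x (r • x)} = {b} := by
      ext ζ
      constructor
      · rintro ⟨hζ, h⟩
        have hζ0 := (h𝓑 hζ).1
        have h' := (zScaleRel_iff (r := Units.mk0 ζ hζ0)).mp h
        exact huniq ζ ⟨hζ, (smul_eq_smul_iff hH).mp h'.symm⟩
      · rintro rfl
        exact ⟨hb, (zScaleRel_iff (r := Units.mk0 ζ hb0)).mpr
          ((smul_eq_smul_iff hH (r := Units.mk0 ζ hb0)).mpr hbr).symm⟩
    rw [basisFun, hset, finsum_mem_singleton]
    have hrb : (r : ℚ) / b ≠ 0 := div_ne_zero r.ne_zero hb0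
    have hq : qRat K 𝔽 (r / b) = 1 := by
      rw [← qstar_algebraMap 𝔽 hrb]
      exact hbr.2
    have := qRat_mul (K := K) 𝔽 hrb hb0
    rw [div_mul_cancel₀ _ hb0, hq, one_mul] at this
    rw [this]
  · intro x x' h
    have hset : {ζ : ℚ | ζ ∈ 𝓑 ∧ zScaleRel K (KSqSet K 𝔽 (pdN 𝔽 K N) Mlev
        (algebraMap (𝓞 K) K ω)) ζ x x'} = ∅ := by
      ext ζ
      simp only [Set.mem_ofPred_eq, Set.mem_empty_iff_false, iff_false]
      rintro ⟨hζ, h'⟩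
      exact h (Units.mk0 ζ (h𝓑 hζ).1) (mem_scalarGroup_iff.mpr (h𝓑 hζ)) (zScaleRel_iff.mp h')
    rw [basisFun, hset, finsum_mem_empty]
  · intro f
    refine and_congr (by simp only [zRel_iff]) ⟨fun h r hr x => ?_, fun h r hr y y' hy => ?_⟩
    · obtain ⟨y, rfl⟩ := Quot.exists_rep x
      exact h r (mem_scalarGroup_iff.mp hr) y (y.scale r) rfl
    · rw [smul_mkX (r := Units.mk0 r hr.1) hy]
      exact h (Units.mk0 r hr.1) (mem_scalarGroup_iff.mpr hr) _

end AD
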